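/- Let Γ be a connected metric graph of first Betti number b ≥ 3 and total length b. There exist at least ⌈b/2⌉ homologically independent simple loops in Γ, each of length at most 12 log(b). -/

import Mathlib

/-- A metric graph: a finite graph (multiple edges and loops allowed) with a
nonnegative length assigned to each edge. -/
structure MGraph where
  V : Type
  E : Type
  fV : Fintype V
  fE : Fintype E
  deV : DecidableEq V
  deE : DecidableEq E
  s : E → V
  t : E → V
  len : E → ℝ
  len_nonneg : ∀ e, 0 ≤ len e

attribute [instance] MGraph.fV MGraph.fE MGraph.deV MGraph.deE

namespace MGraph

variable (G : MGraph)

/-- The total length (one-dimensional Hausdorff measure) of the metric graph. -/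
def totalLength : ℝ := ∑ e, G.len e

/-- A dart is an edge together with an orientation. -/
def dstart (d : G.E × Bool) : G.V := if d.2 then G.s d.1 else G.t d.1

def dend (d : G.E × Bool) : G.V := if d.2 then G.t d.1 else G.s d.1

/-- `G.IsWalk u v l` : the list of darts `l` is a walk from `u` to `v`. -/
def IsWalk : G.V → G.V → List (G.E × Bool) → Prop
  | u, v, [] => u = v
  | u, v, d :: l => G.dstart d = u ∧ IsWalk (G.dend d) v l

/-- The length of a walk. -/
def walkLen (l : List (G.E × Bool)) : ℝ := (l.map fun d => G.len d.1).sum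

/-- The real cycle vector of a closed walk: its class in `H₁(Γ, ℝ) ⊆ ℝ^E`, recording
the signed number of times each edge is traversed. A family of loops is homologically
independent iff their cycle vectors are linearly independent. -/
def cycVec (l : List (G.E × Bool)) : G.E → ℝ := fun e =>
  (l.map fun d => if d.1 = e then (if d.2 then (1 : ℝ) else -1) else 0).sum

/-- The graph is connected. -/
def Connected : Prop := ∀ u v : G.V, ∃ l, G.IsWalk u v l

/-- `G.bettiEq b` : the first Betti number `e - v + 1` of the connected graph `G`
equals `b`. -/
def bettiEq (b : ℕ) : Prop :=
  (Fintype.card G.E : ℤ) - (Fintype.card G.V : ℤ) + 1 = (b : ℤ)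

/-- The path distance between two vertices. -/
noncomputable def vdist (u v : G.V) : ℝ :=
  sInf {x | ∃ l, G.IsWalk u v l ∧ G.walkLen l = x}

/-- The list of vertices visited by a walk. -/
def walkVerts (l : List (G.E × Bool)) : List G.V := l.map G.dstart

/-- The distance from a vertex to a (nonempty) walk. -/
noncomputable def distToWalk (x : G.V) (l : List (G.E × Bool)) : ℝ :=
  sInf {d | ∃ v ∈ G.walkVerts l, G.vdist x v = d}

/-- The distance between two loops. -/
noncomputable def loopDist (l₁ l₂ : List (G.E × Bool)) : ℝ :=
  sInf {d | ∃ u ∈ G.walkVerts l₁, ∃ v ∈ G.walkVerts l₂, G.vdist u v = d}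

/-- A simple loop (embedded circle): a nonempty closed walk repeating no edge and
no vertex. -/
def IsSimpleLoop (l : List (G.E × Bool)) : Prop :=
  l ≠ [] ∧ (∃ v, G.IsWalk v v l) ∧ (l.map Prod.fst).Nodup ∧ (G.walkVerts l).Nodup

end MGraph

namespace MGraph

variable {G : MGraph}

theorem isWalk_append {u w : G.V} {l₁ l₂ : List (G.E × Bool)} :
    G.IsWalk u w (l₁ ++ l₂) ↔ ∃ x, G.IsWalk u x l₁ ∧ G.IsWalk x w l₂ := by
  induction l₁ generalizing u with
  | nil => simp [IsWalk]
  | cons d l ih => simp [IsWalk, ih, and_assoc]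

theorem walkLen_nil : G.walkLen [] = 0 := by simp [walkLen]

theorem walkLen_cons (d : G.E × Bool) (l : List (G.E × Bool)) :
    G.walkLen (d :: l) = G.len d.1 + G.walkLen l := by simp [walkLen]

theorem walkLen_append (l₁ l₂ : List (G.E × Bool)) :
    G.walkLen (l₁ ++ l₂) = G.walkLen l₁ + G.walkLen l₂ := by simp [walkLen]

theorem walkLen_nonneg (l : List (G.E × Bool)) : 0 ≤ G.walkLen l := by
  induction l with
  | nil => simp [walkLen]
  | cons d l ih => rw [walkLen_cons]; have := G.len_nonneg d.1; linarith

theorem walkLen_sublist {l₁ l₂ : List (G.E × Bool)} (h : l₁.Sublist l₂) :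
    G.walkLen l₁ ≤ G.walkLen l₂ := by
  induction h with
  | slnil => exact le_refl _
  | cons a h ih => rw [walkLen_cons]; have := G.len_nonneg a.1; linarith
  | cons_cons a h ih => rw [walkLen_cons, walkLen_cons]; linarith

/-- The reversed walk. -/
def revWalk (l : List (G.E × Bool)) : List (G.E × Bool) :=
  (l.map fun d => (d.1, !d.2)).reverse

theorem isWalk_rev {u w : G.V} {l : List (G.E × Bool)} (h : G.IsWalk u w l) :
    G.IsWalk w u (revWalk l) := by
  induction l generalizing u with
  | nil => exact h.symm
  | cons d l ih =>
    obtain ⟨h1, h2⟩ := h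
    have := ih h2
    simp only [revWalk, List.map_cons, List.reverse_cons]
    refine isWalk_append.2 ⟨_, this, ?_, ?_⟩
    · obtain ⟨e, b⟩ := d
      cases b <;> simp [dstart, dend]
    · rw [← h1]
      obtain ⟨e, b⟩ := d
      cases b <;> simp [IsWalk, dstart, dend]

theorem walkLen_rev (l : List (G.E × Bool)) : G.walkLen (revWalk l) = G.walkLen l := by
  simp [walkLen, revWalk, Function.comp_def]

theorem mem_rev {l : List (G.E × Bool)} {x : G.E × Bool} (h : x ∈ revWalk l) :
    ∃ y ∈ l, y.1 = x.1 := by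
  simp only [revWalk, List.mem_reverse, List.mem_map] at h
  obtain ⟨y, hy, rfl⟩ := h
  exact ⟨y, hy, rfl⟩

theorem exists_suffix {u x w : G.V} {p : List (G.E × Bool)} (h : G.IsWalk x w p)
    (hu : u ∈ G.walkVerts p ++ [w]) : ∃ q, q <:+ p ∧ G.IsWalk u w q := by
  induction p generalizing x with
  | nil =>
    simp [walkVerts] at hu
    exact ⟨[], List.suffix_refl _, hu⟩
  | cons d p ih =>
    obtain ⟨h1, h2⟩ := h
    simp only [walkVerts, List.map_cons, List.cons_append, List.mem_cons] at hu
    rcases hu with rfl | hu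
    · exact ⟨d :: p, List.suffix_refl _, rfl, h2⟩
    · obtain ⟨q, hq, hq'⟩ := ih h2 hu
      exact ⟨q, hq.trans (List.suffix_cons _ _), hq'⟩

theorem exists_path {u w : G.V} {l : List (G.E × Bool)} (h : G.IsWalk u w l) :
    ∃ p, p.Sublist l ∧ G.IsWalk u w p ∧ (G.walkVerts p ++ [w]).Nodup := by
  induction l generalizing u with
  | nil => exact ⟨[], List.Sublist.refl _, h, by simp [walkVerts]⟩
  | cons d l ih =>
    obtain ⟨h1, h2⟩ := h
    obtain ⟨p, hp, hw, hn⟩ := ih h2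
    by_cases hu : u ∈ G.walkVerts p ++ [w]
    · obtain ⟨q, hq, hq'⟩ := exists_suffix hw hu
      refine ⟨q, (hq.sublist.trans hp).trans (List.sublist_cons_self _ _), hq', ?_⟩
      exact hn.sublist (((hq.sublist).map _).append (List.Sublist.refl _))
    · refine ⟨d :: p, hp.cons_cons d, ⟨h1, hw⟩, ?_⟩
      simp only [walkVerts, List.map_cons, List.cons_append, List.nodup_cons]
      rw [h1]
      exact ⟨hu, hn⟩

theorem ends_mem {u w : G.V} {l : List (G.E × Bool)} (h : G.IsWalk u w l)
    {d : G.E × Bool} (hd : d ∈ l) :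
    G.dstart d ∈ G.walkVerts l ++ [w] ∧ G.dend d ∈ G.walkVerts l ++ [w] := by
  constructor
  · exact List.mem_append_left _ (List.mem_map_of_mem hd)
  · induction l generalizing u with
    | nil => simp at hd
    | cons a l ih =>
      obtain ⟨h1, h2⟩ := h
      rcases List.mem_cons.1 hd with rfl | hd
      · simp only [walkVerts, List.map_cons, List.cons_append]
        apply List.mem_cons_of_mem
        cases l with
        | nil => simp only [IsWalk] at h2; simp [h2]
        | cons c l => simp [h2.1]
      · simp only [walkVerts, List.map_cons, List.cons_append]
        exact List.mem_cons_of_mem _ (ih h2 hd)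

theorem path_edges_nodup {u w : G.V} {l : List (G.E × Bool)} (h : G.IsWalk u w l)
    (hn : (G.walkVerts l ++ [w]).Nodup) : (l.map Prod.fst).Nodup := by
  induction l generalizing u with
  | nil => simp
  | cons d l ih =>
    obtain ⟨h1, h2⟩ := h
    simp only [walkVerts, List.map_cons, List.cons_append, List.nodup_cons] at hn
    simp only [List.map_cons, List.nodup_cons]
    refine ⟨?_, ih h2 hn.2⟩
    intro hd
    obtain ⟨d', hd', he⟩ := List.mem_map.1 hd
    have := ends_mem h2 hd'
    apply hn.1
    obtain ⟨e, b⟩ := d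
    obtain ⟨e', b'⟩ := d'
    simp only at he
    subst he
    cases b <;> cases b' <;> simp_all [dstart, dend, walkVerts]

theorem cycVec_eq_zero {l : List (G.E × Bool)} {e : G.E} (h : ∀ x ∈ l, x.1 ≠ e) :
    G.cycVec l e = 0 := by
  induction l with
  | nil => simp [cycVec]
  | cons d l ih =>
    have h1 := ih (fun x hx => h x (List.mem_cons_of_mem _ hx))
    have h2 := h d List.mem_cons_self
    simp only [cycVec] at h1
    simp [cycVec, h1, h2]

/-- A walk closing up an edge which it avoids yields a simple loop. -/
theorem exists_loop {e : G.E} {l : List (G.E × Bool)} (h : G.IsWalk (G.t e) (G.s e) l)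
    (he : ∀ x ∈ l, x.1 ≠ e) :
    ∃ c, G.IsSimpleLoop c ∧ G.walkLen c ≤ G.len e + G.walkLen l ∧
      (∀ x ∈ c, x.1 = e ∨ ∃ y ∈ l, y.1 = x.1) ∧ G.cycVec c e ≠ 0 := by
  obtain ⟨p, hp, hw, hn⟩ := exists_path h
  have hep : ∀ x ∈ p, x.1 ≠ e := fun x hx => he x (hp.subset hx)
  refine ⟨(e, true) :: p, ⟨by simp, ⟨G.s e, by simp [dstart], by simpa [dend] using hw⟩, ?_, ?_⟩,
    ?_, ?_, ?_⟩
  · simp only [List.map_cons, List.nodup_cons]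
    refine ⟨?_, path_edges_nodup hw hn⟩
    intro hm
    obtain ⟨x, hx, hxe⟩ := List.mem_map.1 hm
    exact hep x hx hxe
  · simp only [walkVerts, List.map_cons, List.nodup_cons]
    have := List.nodup_append_comm.1 hn
    simpa [walkVerts, dstart] using this
  · rw [walkLen_cons]
    have := walkLen_sublist hp
    linarith
  · intro x hx
    rcases List.mem_cons.1 hx with rfl | hx
    · exact Or.inl rfl
    · exact Or.inr ⟨x, hp.subset hx, rfl⟩
  · have h1 := cycVec_eq_zero hep
    simp only [cycVec] at h1
    simp [cycVec, h1]

theorem exists_opt (F : Finset G.E) {v u : G.V}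
    (h : ∃ l, G.IsWalk v u l ∧ ∀ x ∈ l, x.1 ∈ F) :
    ∃ l, (G.IsWalk v u l ∧ ∀ x ∈ l, x.1 ∈ F) ∧
      ∀ l', (G.IsWalk v u l' ∧ ∀ x ∈ l', x.1 ∈ F) →
        G.walkLen l < G.walkLen l' ∨ (G.walkLen l = G.walkLen l' ∧ l.length ≤ l'.length) := by
  let B : Set (List (G.E × Bool)) :=
    {l | (G.IsWalk v u l ∧ ∀ x ∈ l, x.1 ∈ F) ∧ l.length ≤ Fintype.card G.V}
  have key : ∀ l, (G.IsWalk v u l ∧ ∀ x ∈ l, x.1 ∈ F) → ∃ p ∈ B, p.Sublist l := by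
    rintro l ⟨hl, hF⟩
    obtain ⟨p, hp, hw, hn⟩ := exists_path hl
    refine ⟨p, ⟨⟨hw, fun x hx => hF x (hp.subset hx)⟩, ?_⟩, hp⟩
    have := hn.length_le_card
    simp [walkVerts] at this
    omega
  have hfin : B.Finite :=
    (List.finite_length_le (G.E × Bool) (Fintype.card G.V)).subset (fun l hl => hl.2)
  obtain ⟨l0, hl0⟩ := h
  obtain ⟨p0, hp0, -⟩ := key l0 hl0
  obtain ⟨m, hm, hmin⟩ := Set.exists_min_image B
    (fun l => (toLex (G.walkLen l, l.length) : ℝ ×ₗ ℕ)) hfin ⟨p0, hp0⟩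
  refine ⟨m, hm.1, fun l' hl' => ?_⟩
  obtain ⟨p, hp, hs⟩ := key l' hl'
  have h1 := hmin p hp
  rw [Prod.Lex.toLex_le_toLex] at h1
  have h2 := walkLen_sublist hs
  have h3 := hs.length_le
  simp only at h1
  rcases h1 with h1 | ⟨h1, h1'⟩
  · left; linarith
  · rcases h2.lt_or_eq with h2 | h2
    · left; linarith
    · right; exact ⟨by linarith, by omega⟩

/-- Distances and parent edges from a root `v` inside the edge set `F`. -/
theorem exists_dist (F : Finset G.E) (v : G.V) (M : ℝ) (hM : 0 ≤ M) :
    ∃ (d : G.V → ℝ) (P : G.V → Option G.E), (∀ u, 0 ≤ d u) ∧ d v = 0 ∧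
      (∀ e ∈ F, d (G.t e) ≤ d (G.s e) + G.len e ∧ d (G.s e) ≤ d (G.t e) + G.len e) ∧
      (∀ u, d u < M → ∃ l, G.IsWalk v u l ∧ G.walkLen l ≤ d u ∧
        ∀ x ∈ l, x.1 ∈ F ∧ ∃ w, w ≠ v ∧ d w ≤ d u ∧ P w = some x.1) := by
  classical
  let A : G.V → List (G.E × Bool) → Prop := fun u l => G.IsWalk v u l ∧ ∀ x ∈ l, x.1 ∈ F
  have hopt : ∀ u, ∃ l, (∃ l, A u l) → (A u l ∧ ∀ l', A u l' →
        G.walkLen l < G.walkLen l' ∨ (G.walkLen l = G.walkLen l' ∧ l.length ≤ l'.length)) := by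
    intro u
    by_cases h : ∃ l, A u l
    · obtain ⟨l, hl⟩ := exists_opt F h
      exact ⟨l, fun _ => hl⟩
    · exact ⟨[], fun h' => absurd h' h⟩
  choose o ho using hopt
  have hv : A v [] := ⟨rfl, by simp⟩
  have hov : o v = [] := by
    have h1 := (ho v ⟨_, hv⟩).2 [] hv
    rw [walkLen_nil] at h1
    have h2 := walkLen_nonneg (o v)
    rcases h1 with h1 | ⟨_, h1⟩
    · linarith
    · simpa using h1
  have step : ∀ (u : G.V) (l : List (G.E × Bool)) (x : G.E × Bool), A u l → x.1 ∈ F →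
      G.dstart x = u → A (G.dend x) (l ++ [x]) := by
    intro u l x hl hx hs
    refine ⟨isWalk_append.2 ⟨u, hl.1, hs, rfl⟩, ?_⟩
    intro y hy
    rcases List.mem_append.1 hy with hy | hy
    · exact hl.2 y hy
    · simp at hy; rw [hy]; exact hx
  let d : G.V → ℝ := fun u => if ∃ l, A u l then G.walkLen (o u) else M
  have hd : ∀ u, (∃ l, A u l) → d u = G.walkLen (o u) := fun u h => if_pos h
  have hd' : ∀ u, (¬ ∃ l, A u l) → d u = M := fun u h => if_neg h
  have lip : ∀ x : G.E × Bool, x.1 ∈ F → d (G.dend x) ≤ d (G.dstart x) + G.len x.1 := by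
    intro x hx
    by_cases h : ∃ l, A (G.dstart x) l
    · have h1 := step _ _ x (ho _ h).1 hx rfl
      rw [hd _ h, hd _ ⟨_, h1⟩]
      have h2 := (ho _ ⟨_, h1⟩).2 _ h1
      rw [walkLen_append, walkLen_cons, walkLen_nil] at h2
      rcases h2 with h2 | h2 <;> linarith
    · have h' : ¬ ∃ l, A (G.dend x) l := by
        rintro ⟨l, hl⟩
        apply h
        have := step _ l (x.1, !x.2) hl hx (by cases hx2 : x.2 <;> simp [dstart, dend, hx2])
        have e : G.dend (x.1, !x.2) = G.dstart x := by
          cases hx2 : x.2 <;> simp [dstart, dend, hx2]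
        rw [e] at this
        exact ⟨_, this⟩
      rw [hd' _ h, hd' _ h']
      have := G.len_nonneg x.1
      linarith
  refine ⟨d, fun u => ((o u).getLast?).map Prod.fst, ?_, ?_, ?_, ?_⟩
  · intro u
    by_cases h : ∃ l, A u l
    · rw [hd u h]; exact walkLen_nonneg _
    · rw [hd' u h]; exact hM
  · rw [hd v ⟨_, hv⟩, hov, walkLen_nil]
  · intro e he
    exact ⟨by simpa [dstart, dend] using lip (e, true) he,
      by simpa [dstart, dend] using lip (e, false) he⟩
  · have main : ∀ n : ℕ, ∀ u, (∃ l, A u l) → (o u).length = n →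
        ∃ l, G.IsWalk v u l ∧ G.walkLen l ≤ d u ∧
        ∀ x ∈ l, x.1 ∈ F ∧ ∃ w, w ≠ v ∧ d w ≤ d u ∧ ((o w).getLast?).map Prod.fst = some x.1 := by
      intro n
      induction n using Nat.strong_induction_on with
      | _ n ih =>
        intro u hu hn
        obtain ⟨hA, hmin⟩ := ho u hu
        rcases List.eq_nil_or_concat (o u) with h0 | ⟨q, x, hq⟩
        · rw [h0] at hA
          refine ⟨[], hA.1, ?_, by simp⟩
          rw [hd u hu, h0]
        · have huv : u ≠ v := by
            rintro rfl
            rw [hov] at hq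
            simp at hq
          rw [List.concat_eq_append] at hq
          have hA' := hA
          rw [hq] at hA'
          obtain ⟨y, hy1, hy2, hy3⟩ := isWalk_append.1 hA'.1
          have hy3 : G.dend x = u := hy3
          have hxF : x.1 ∈ F := hA'.2 x (by simp)
          have hAq : A y q := ⟨hy1, fun z hz => hA'.2 z (List.mem_append_left _ hz)⟩
          obtain ⟨hAy, hminy⟩ := ho y ⟨_, hAq⟩
          have h1 := hminy q hAq
          have h2 := step y (o y) x hAy hxF hy2
          rw [hy3] at h2
          have h3 := hmin _ h2
          rw [hq, walkLen_append, walkLen_append] at h3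
          have hlen : (o u).length = q.length + 1 := by rw [hq]; simp
          have h4 : G.walkLen (o y) = G.walkLen q := by
            rcases h1 with h1 | h1 <;> rcases h3 with h3 | h3 <;> linarith [h1, h3]
          have h5 : (o y).length ≤ q.length := by
            rcases h1 with h1 | h1
            · linarith
            · exact h1.2
          obtain ⟨m, hm1, hm2, hm3⟩ := ih _ (by omega : (o y).length < n) y ⟨_, hAq⟩ rfl
          have hdu : d u = d y + G.len x.1 := by
            rw [hd u hu, hd y ⟨_, hAq⟩, hq, walkLen_append, walkLen_cons, walkLen_nil, h4]
            ring
          have hx0 := G.len_nonneg x.1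
          refine ⟨m ++ [x], isWalk_append.2 ⟨y, hm1, hy2, hy3⟩, ?_, ?_⟩
          · rw [walkLen_append, walkLen_cons, walkLen_nil]; linarith
          · intro z hz
            rcases List.mem_append.1 hz with hz | hz
            · obtain ⟨hz1, w, hw1, hw2, hw3⟩ := hm3 z hz
              exact ⟨hz1, w, hw1, by linarith, hw3⟩
            · simp at hz
              subst hz
              exact ⟨hxF, u, huv, le_refl _, by rw [hq]; simp⟩
    intro u hu
    by_cases h : ∃ l, A u l
    · exact main _ u h rfl
    · rw [hd' u h] at hu
      exact absurd hu (lt_irrefl _)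

end MGraph

namespace MGraph

variable {G : MGraph}

/-- Abstract region growing: a radius at which the number of growing indices is controlled. -/
theorem grow {ι : Type} [DecidableEq ι] (F : Finset ι) (len a a' : ι → ℝ) (R lam : ℝ)
    (hR : 0 < R) (hlam : 0 < lam) (hlen : ∀ e, 0 ≤ len e)
    (hexp : 1 + 3 / 2 * lam * ∑ e ∈ F, len e ≤ Real.exp (lam * R)) :
    ∃ r, 0 ≤ r ∧ r < R ∧
      (((F.filter fun e => (a e ≤ r ∨ a' e ≤ r) ∧
        max (r - a e) 0 + max (r - a' e) 0 < len e).card : ℝ)) ≤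
      1 + 3 / 2 * lam * ∑ e ∈ F, min (len e) (max (r - a e) 0 + max (r - a' e) 0) := by
  set c : ι → ℝ → ℝ := fun e r => min (len e) (max (r - a e) 0 + max (r - a' e) 0) with hc
  set f : ℝ → ℝ := fun r => 1 / (3 / 2 * lam) + ∑ e ∈ F, c e r with hf
  have hmu : 0 < 3 / 2 * lam := by linarith
  have hc0 : ∀ e r, 0 ≤ c e r := fun e r => le_min (hlen e) (by positivity)
  have hfpos : ∀ r, 1 / (3 / 2 * lam) ≤ f r := fun r => by
    simp only [hf]
    have := Finset.sum_nonneg (fun e (_ : e ∈ F) => hc0 e r)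
    linarith
  have hf0 : ∀ r, 0 < f r := fun r => lt_of_lt_of_le (by positivity) (hfpos r)
  have hcont : Continuous f := by
    simp only [hf, hc]
    fun_prop
  set h : ℝ → ℝ := fun r => f r * Real.exp (-(lam * r)) with hh
  have hhcont : Continuous h := by
    simp only [hh]
    fun_prop
  have hR0 : h R ≤ h 0 := by
    simp only [hh]
    have h1 : f R ≤ 1 / (3 / 2 * lam) + ∑ e ∈ F, len e := by
      simp only [hf]
      gcongr
      exact min_le_left _ _
    have h2 : 1 / (3 / 2 * lam) + ∑ e ∈ F, len e ≤ 1 / (3 / 2 * lam) * Real.exp (lam * R) := by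
      have := mul_le_mul_of_nonneg_left hexp (by positivity : 0 ≤ 1 / (3 / 2 * lam))
      calc _ = 1 / (3 / 2 * lam) * (1 + 3 / 2 * lam * ∑ e ∈ F, len e) := by
            field_simp
        _ ≤ _ := this
    have h3 : f R ≤ f 0 * Real.exp (lam * R) :=
      (h1.trans h2).trans (mul_le_mul_of_nonneg_right (hfpos 0) (Real.exp_pos _).le)
    calc f R * Real.exp (-(lam * R)) ≤ f 0 * Real.exp (lam * R) * Real.exp (-(lam * R)) :=
          mul_le_mul_of_nonneg_right h3 (Real.exp_pos _).le
      _ = f 0 * Real.exp (-(lam * 0)) := by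
          rw [mul_assoc, ← Real.exp_add]; simp
  have hmax : ∃ r, 0 ≤ r ∧ r < R ∧ ∀ x, 0 ≤ x → x ≤ R → h x ≤ h r := by
    obtain ⟨r, hr, hrm⟩ := (isCompact_Icc (a := (0:ℝ)) (b := R)).exists_isMaxOn
      ⟨0, by simp [hR.le]⟩ hhcont.continuousOn
    rcases hr.2.lt_or_eq with h1 | h1
    · exact ⟨r, hr.1, h1, fun x hx hx' => hrm ⟨hx, hx'⟩⟩
    · refine ⟨0, le_refl _, hR, fun x hx hx' => ?_⟩
      have : h x ≤ h r := hrm ⟨hx, hx'⟩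
      rw [h1] at this
      exact this.trans hR0
  obtain ⟨r, hr0, hrR, hmax⟩ := hmax
  refine ⟨r, hr0, hrR, ?_⟩
  set X := F.filter fun e => (a e ≤ r ∨ a' e ≤ r) ∧
        max (r - a e) 0 + max (r - a' e) 0 < len e with hX
  have hgap : ∃ δ, 0 < δ ∧ ∀ e ∈ X, max (r - a e) 0 + max (r - a' e) 0 + δ ≤ len e := by
    rcases X.eq_empty_or_nonempty with h0 | hne
    · exact ⟨1, one_pos, by simp [h0]⟩
    · obtain ⟨e, he, hmin⟩ := X.exists_min_image
        (fun e => len e - (max (r - a e) 0 + max (r - a' e) 0)) hne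
      refine ⟨len e - (max (r - a e) 0 + max (r - a' e) 0), ?_, fun e' he' => ?_⟩
      · have := (Finset.mem_filter.1 he).2.2
        linarith
      · have := hmin e' he'
        linarith
  obtain ⟨δ, hδ, hgap⟩ := hgap
  obtain ⟨ε, hε, hε1, hε2, hε3⟩ : ∃ ε, 0 < ε ∧ ε ≤ δ ∧ ε ≤ R - r ∧ lam * ε ≤ 1 / 2 := by
    refine ⟨min δ (min (R - r) (1 / 2 / lam)), ?_, min_le_left _ _,
      (min_le_right _ _).trans (min_le_left _ _), ?_⟩
    · exact lt_min hδ (lt_min (by linarith) (by positivity))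
    · have : min δ (min (R - r) (1 / 2 / lam)) ≤ 1 / 2 / lam :=
        (min_le_right _ _).trans (min_le_right _ _)
      rw [le_div_iff₀ hlam] at this
      linarith
  have hmono : ∀ e, c e r ≤ c e (r + ε) := by
    intro e
    simp only [hc]
    gcongr <;> linarith
  have hstep : ∀ e ∈ X, c e r + ε ≤ c e (r + ε) := by
    intro e he
    have h1 := hgap e he
    have h2 := (Finset.mem_filter.1 he).2.1
    have hcr : c e r ≤ max (r - a e) 0 + max (r - a' e) 0 := min_le_right _ _
    refine le_min (by linarith) (le_trans (add_le_add_left hcr ε) ?_)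
    have m1 : max (r - a e) 0 ≤ max (r + ε - a e) 0 := by gcongr; linarith
    have m2 : max (r - a' e) 0 ≤ max (r + ε - a' e) 0 := by gcongr; linarith
    rcases h2 with h2 | h2
    · have : max (r - a e) 0 = r - a e := max_eq_left (by linarith)
      have := le_max_left (r + ε - a e) 0
      linarith
    · have : max (r - a' e) 0 = r - a' e := max_eq_left (by linarith)
      have := le_max_left (r + ε - a' e) 0
      linarith
  have hsum : f r + X.card * ε ≤ f (r + ε) := by
    have hXF : X ⊆ F := Finset.filter_subset _ _
    have h1 : ∑ e ∈ F, (c e r + if e ∈ X then ε else 0) ≤ ∑ e ∈ F, c e (r + ε) := by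
      apply Finset.sum_le_sum
      intro e _
      split_ifs with he
      · exact hstep e he
      · rw [add_zero]; exact hmono e
    rw [Finset.sum_add_distrib, Finset.sum_ite_mem, Finset.inter_eq_right.2 hXF,
      Finset.sum_const, nsmul_eq_mul] at h1
    simp only [hf]
    linarith
  have hup : f (r + ε) ≤ f r * (1 + 3 / 2 * (lam * ε)) := by
    have h1 := hmax (r + ε) (by linarith) (by linarith)
    simp only [hh] at h1
    have h2 : f (r + ε) ≤ f r * Real.exp (lam * ε) := by
      have := mul_le_mul_of_nonneg_right h1 (Real.exp_pos (lam * (r + ε))).le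
      rw [mul_assoc, mul_assoc, ← Real.exp_add, ← Real.exp_add] at this
      simp only [neg_add_cancel, Real.exp_zero, mul_one] at this
      rwa [show -(lam * r) + lam * (r + ε) = lam * ε by ring] at this
    refine h2.trans (mul_le_mul_of_nonneg_left ?_ (hf0 r).le)
    have hpos : 0 < lam * ε := by positivity
    have h3 := Real.abs_exp_sub_one_sub_id_le (x := lam * ε) (by rw [abs_of_pos hpos]; linarith)
    have h4 := (abs_le.1 h3).2
    nlinarith
  have h5 : (X.card : ℝ) * ε ≤ (3 / 2 * lam * f r) * ε := by nlinarith
  have h6 : (X.card : ℝ) ≤ 3 / 2 * lam * f r := le_of_mul_le_mul_right h5 hε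
  have h7 : 3 / 2 * lam * f r = 1 + 3 / 2 * lam * ∑ e ∈ F, c e r := by
    simp only [hf]
    field_simp
  linarith

theorem ball_step (F : Finset G.E) (v : G.V) (R lam : ℝ) (hR : 0 < R) (hlam : 0 < lam)
    (hexp : 1 + 3 / 2 * lam * ∑ e ∈ F, G.len e ≤ Real.exp (lam * R))
    (hno : ∀ e ∈ F, ∀ l, G.IsWalk (G.t e) (G.s e) l → (∀ x ∈ l, x.1 ∈ F) →
      (∀ x ∈ l, x.1 ≠ e) → 2 * R < G.len e + G.walkLen l) :
    ∃ S : Finset G.V, v ∈ S ∧ (∀ u ∈ S, ∃ l, G.IsWalk v u l ∧ ∀ x ∈ l, x.1 ∈ F) ∧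
      (((F.filter fun e => G.s e ∈ S ∨ G.t e ∈ S).card : ℝ) ≤
        3 / 2 * lam * (∑ e ∈ F.filter fun e => G.s e ∈ S ∨ G.t e ∈ S, G.len e) + S.card) := by
  classical
  obtain ⟨d, P, hd0, hdv, hlip, htree⟩ := exists_dist F v R hR.le
  obtain ⟨r, hr0, hrR, hX⟩ := grow F G.len (fun e => d (G.s e)) (fun e => d (G.t e)) R lam hR hlam
    G.len_nonneg hexp
  set S : Finset G.V := Finset.univ.filter fun u => d u ≤ r with hS
  have hmS : ∀ u, u ∈ S ↔ d u ≤ r := fun u => by simp [hS]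
  have hvS : v ∈ S := by rw [hmS, hdv]; exact hr0
  refine ⟨S, hvS, ?_, ?_⟩
  · intro u hu
    obtain ⟨l, h1, -, h3⟩ := htree u (lt_of_le_of_lt ((hmS u).1 hu) hrR)
    exact ⟨l, h1, fun x hx => (h3 x hx).1⟩
  simp only [hmS]
  set FS := F.filter fun e => d (G.s e) ≤ r ∨ d (G.t e) ≤ r with hFS
  have hsplit := Finset.card_filter_add_card_filter_not (s := FS)
    (fun e => max (r - d (G.s e)) 0 + max (r - d (G.t e)) 0 < G.len e)
  rw [hFS, Finset.filter_filter, ← hFS] at hsplit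
  -- tree edges
  have hT : (FS.filter fun e => ¬ (max (r - d (G.s e)) 0 + max (r - d (G.t e)) 0 < G.len e)).card
      ≤ S.card - 1 := by
    rw [← Finset.card_erase_of_mem hvS]
    set T := FS.filter fun e => ¬ (max (r - d (G.s e)) 0 + max (r - d (G.t e)) 0 < G.len e)
    have hsub : T.image some ⊆ (S.erase v).image P := by
      intro oe hoe
      obtain ⟨e, he, rfl⟩ := Finset.mem_image.1 hoe
      obtain ⟨he1, he2⟩ := Finset.mem_filter.1 he
      obtain ⟨heF, he1⟩ := Finset.mem_filter.1 he1
      rw [not_lt] at he2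
      obtain ⟨l1, l2⟩ := hlip e heF
      have hboth : d (G.s e) ≤ r ∧ d (G.t e) ≤ r := by
        by_contra hcon
        rcases he1 with h | h
        · have h' : r < d (G.t e) := by
            by_contra h'; exact hcon ⟨h, not_lt.1 h'⟩
          rw [max_eq_left (by linarith), max_eq_right (by linarith)] at he2
          linarith
        · have h' : r < d (G.s e) := by
            by_contra h'; exact hcon ⟨not_lt.1 h', h⟩
          rw [max_eq_right (by linarith), max_eq_left (by linarith)] at he2
          linarith
      obtain ⟨hs, ht⟩ := hboth
      rw [max_eq_left (by linarith), max_eq_left (by linarith)] at he2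
      by_contra hnot
      have hP : ∀ w, w ≠ v → d w ≤ r → P w ≠ some e := by
        intro w hw hwr hPw
        exact hnot (Finset.mem_image.2 ⟨w, Finset.mem_erase.2 ⟨hw, (hmS w).2 hwr⟩, hPw⟩)
      obtain ⟨p, p1, p2, p3⟩ := htree _ (lt_of_le_of_lt hs hrR)
      obtain ⟨q, q1, q2, q3⟩ := htree _ (lt_of_le_of_lt ht hrR)
      have hp : ∀ x ∈ p, x.1 ∈ F ∧ x.1 ≠ e := by
        intro x hx
        obtain ⟨a, w, b1, b2, b3⟩ := p3 x hx
        exact ⟨a, fun hxe => hP w b1 (b2.trans hs) (hxe ▸ b3)⟩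
      have hq : ∀ x ∈ q, x.1 ∈ F ∧ x.1 ≠ e := by
        intro x hx
        obtain ⟨a, w, b1, b2, b3⟩ := q3 x hx
        exact ⟨a, fun hxe => hP w b1 (b2.trans ht) (hxe ▸ b3)⟩
      have hall : ∀ x ∈ revWalk q ++ p, x.1 ∈ F ∧ x.1 ≠ e := by
        intro x hx
        rcases List.mem_append.1 hx with hx | hx
        · obtain ⟨y, hy, hyx⟩ := mem_rev hx
          rw [← hyx]; exact hq y hy
        · exact hp x hx
      have := hno e heF (revWalk q ++ p) (isWalk_append.2 ⟨v, isWalk_rev q1, p1⟩)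
        (fun x hx => (hall x hx).1) (fun x hx => (hall x hx).2)
      rw [walkLen_append, walkLen_rev] at this
      linarith
    calc T.card = (T.image some).card :=
          (Finset.card_image_of_injective _ (Option.some_injective _)).symm
      _ ≤ ((S.erase v).image P).card := Finset.card_le_card hsub
      _ ≤ (S.erase v).card := Finset.card_image_le
  have hSpos : 0 < S.card := Finset.card_pos.2 ⟨v, hvS⟩
  have hsum : ∑ e ∈ F, min (G.len e) (max (r - d (G.s e)) 0 + max (r - d (G.t e)) 0) ≤
      ∑ e ∈ FS, G.len e := by
    rw [hFS, Finset.sum_filter]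
    apply Finset.sum_le_sum
    intro e _
    split_ifs with h
    · exact min_le_left _ _
    · push Not at h
      rw [max_eq_right (by linarith), max_eq_right (by linarith), add_zero]
      exact min_le_right _ _
  have hmul := mul_le_mul_of_nonneg_left hsum (by positivity : 0 ≤ 3 / 2 * lam)
  have hcard : FS.card + 1 ≤ (F.filter fun e => (d (G.s e) ≤ r ∨ d (G.t e) ≤ r) ∧
        max (r - d (G.s e)) 0 + max (r - d (G.t e)) 0 < G.len e).card + S.card := by
    omega
  have hcard' : (FS.card : ℝ) + 1 ≤ (F.filter fun e => (d (G.s e) ≤ r ∨ d (G.t e) ≤ r) ∧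
        max (r - d (G.s e)) 0 + max (r - d (G.t e)) 0 < G.len e).card + S.card := by
    exact_mod_cast hcard
  linarith

theorem walk_mem {F : Finset G.E} {U : Finset G.V} (hU : ∀ e ∈ F, G.s e ∈ U ∧ G.t e ∈ U)
    {v u : G.V} (hv : v ∈ U) {l : List (G.E × Bool)} (h : G.IsWalk v u l)
    (hl : ∀ x ∈ l, x.1 ∈ F) : u ∈ U := by
  induction l generalizing v with
  | nil => rw [← (show v = u from h)]; exact hv
  | cons d l ih =>
    refine ih ?_ h.2 (fun x hx => hl x (List.mem_cons_of_mem _ hx))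
    have := hU d.1 (hl d List.mem_cons_self)
    cases hd : d.2 <;> simp [dend, hd, this]

theorem edge_bound (R lam : ℝ) (hR : 0 < R) (hlam : 0 < lam) (U : Finset G.V) :
    ∀ F : Finset G.E, (∀ e ∈ F, G.s e ∈ U ∧ G.t e ∈ U) →
    (1 + 3 / 2 * lam * ∑ e ∈ F, G.len e ≤ Real.exp (lam * R)) →
    (∀ e ∈ F, ∀ l, G.IsWalk (G.t e) (G.s e) l → (∀ x ∈ l, x.1 ∈ F) →
      (∀ x ∈ l, x.1 ≠ e) → 2 * R < G.len e + G.walkLen l) →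
    (F.card : ℝ) ≤ 3 / 2 * lam * (∑ e ∈ F, G.len e) + U.card := by
  induction U using Finset.strongInduction with
  | _ U ih =>
    intro F hU hexp hno
    rcases U.eq_empty_or_nonempty with h0 | ⟨v, hv⟩
    · have : F = ∅ := by
        rw [Finset.eq_empty_iff_forall_notMem]
        intro e he
        have := (hU e he).1
        simp [h0] at this
      simp [this, h0]
    · obtain ⟨S, hvS, hSw, hS⟩ := ball_step F v R lam hR hlam hexp hno
      have hSU : S ⊆ U := by
        intro u hu
        obtain ⟨l, hl, hlF⟩ := hSw u hu
        exact walk_mem hU hv hl hlF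
      set F' := F.filter fun e => ¬ (G.s e ∈ S ∨ G.t e ∈ S) with hF'
      have hF'F : F' ⊆ F := Finset.filter_subset _ _
      have hsum := Finset.sum_filter_add_sum_filter_not F
        (fun e => G.s e ∈ S ∨ G.t e ∈ S) G.len
      have hcard := Finset.card_filter_add_card_filter_not (s := F)
        (fun e => G.s e ∈ S ∨ G.t e ∈ S)
      rw [← hF'] at hsum hcard
      have hrec := ih (U \ S) (Finset.sdiff_ssubset hSU ⟨v, hvS⟩) F' (by
          intro e he
          obtain ⟨he1, he2⟩ := Finset.mem_filter.1 he
          push Not at he2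
          exact ⟨Finset.mem_sdiff.2 ⟨(hU e he1).1, he2.1⟩,
            Finset.mem_sdiff.2 ⟨(hU e he1).2, he2.2⟩⟩) (by
          refine le_trans ?_ hexp
          have : ∑ e ∈ F', G.len e ≤ ∑ e ∈ F, G.len e :=
            Finset.sum_le_sum_of_subset_of_nonneg hF'F (fun e _ _ => G.len_nonneg e)
          gcongr) (by
          intro e he l hl h1 h2
          exact hno e (hF'F he) l hl (fun x hx => hF'F (h1 x hx)) h2)
      have hc1 : ((U \ S).card : ℝ) + S.card = U.card := by
        exact_mod_cast Finset.card_sdiff_add_card_eq_card hSU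
      have hc2 : ((F.filter fun e => G.s e ∈ S ∨ G.t e ∈ S).card : ℝ) + F'.card = F.card := by
        exact_mod_cast hcard
      rw [← hsum, mul_add]
      linarith

theorem loops_aux (R lam L : ℝ) (hR : 0 < R) (hlam : 0 < lam)
    (hexp : 1 + 3 / 2 * lam * L ≤ Real.exp (lam * R)) (k : ℕ) :
    ∀ F : Finset G.E, (∑ e ∈ F, G.len e ≤ L) →
    ((k : ℝ) + Fintype.card G.V + 3 / 2 * lam * L < F.card + 1) →
    ∃ c : Fin k → List (G.E × Bool), (∀ i, G.IsSimpleLoop (c i)) ∧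
      (∀ i, G.walkLen (c i) ≤ 2 * R) ∧ (∀ i, ∀ x ∈ c i, x.1 ∈ F) ∧
      LinearIndependent ℝ (fun i => G.cycVec (c i)) := by
  induction k with
  | zero =>
    intro F _ _
    exact ⟨fun i => i.elim0, fun i => i.elim0, fun i => i.elim0, fun i => i.elim0,
      linearIndependent_empty_type⟩
  | succ k ih =>
    intro F hL hcard
    push_cast at hcard
    have hmul : 3 / 2 * lam * ∑ e ∈ F, G.len e ≤ 3 / 2 * lam * L := by gcongr
    have hex : ∃ e ∈ F, ∃ l, G.IsWalk (G.t e) (G.s e) l ∧ (∀ x ∈ l, x.1 ∈ F) ∧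
        (∀ x ∈ l, x.1 ≠ e) ∧ G.len e + G.walkLen l ≤ 2 * R := by
      by_contra hcon
      push Not at hcon
      have := edge_bound R lam hR hlam Finset.univ F (by simp) (by linarith) hcon
      rw [Finset.card_univ] at this
      have hk : (0:ℝ) ≤ k := Nat.cast_nonneg k
      linarith
    obtain ⟨e, he, l, hl, hlF, hle, hlR⟩ := hex
    obtain ⟨c0, hc1, hc2, hc3, hc4⟩ := exists_loop hl hle
    have hlen' : ∑ e' ∈ F.erase e, G.len e' ≤ L :=
      (Finset.sum_le_sum_of_subset_of_nonneg (Finset.erase_subset _ _)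
        (fun e _ _ => G.len_nonneg e)).trans hL
    have hce : ((F.erase e).card : ℝ) + 1 = F.card := by
      exact_mod_cast Finset.card_erase_add_one he
    obtain ⟨c, g1, g2, g3, g4⟩ := ih (F.erase e) hlen' (by linarith)
    refine ⟨Fin.cons c0 c, ?_, ?_, ?_, ?_⟩
    · intro i
      refine Fin.cases ?_ (fun j => ?_) i
      · exact hc1
      · exact g1 j
    · intro i
      refine Fin.cases ?_ (fun j => ?_) i
      · exact hc2.trans hlR
      · exact g2 j
    · intro i
      refine Fin.cases ?_ (fun j => ?_) i
      · intro x hx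
        rcases hc3 x hx with h | ⟨y, hy, h⟩
        · rw [h]; exact he
        · rw [← h]; exact hlF y hy
      · intro x hx
        exact Finset.mem_of_mem_erase (g3 j x hx)
    · have heq : (fun i => G.cycVec ((Fin.cons c0 c : Fin (k + 1) → List (G.E × Bool)) i)) =
          Fin.cons (G.cycVec c0) (fun i => G.cycVec (c i)) := by
        funext i
        refine Fin.cases ?_ (fun j => ?_) i <;> rfl
      rw [heq, linearIndependent_finCons]
      refine ⟨g4, fun hmem => hc4 ?_⟩
      have hle : Submodule.span ℝ (Set.range fun i => G.cycVec (c i)) ≤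
          LinearMap.ker (LinearMap.proj e : (G.E → ℝ) →ₗ[ℝ] ℝ) := by
        rw [Submodule.span_le]
        rintro _ ⟨i, rfl⟩
        simp only [SetLike.mem_coe, LinearMap.mem_ker, LinearMap.proj_apply]
        exact cycVec_eq_zero (fun x hx => Finset.ne_of_mem_erase (g3 i x hx))
      exact hle hmem

end MGraph

/-- Let `Γ` be a connected metric graph of first Betti number `b ≥ 3`
and total length `b`. There exist at least `⌈b/2⌉` homologically independent simple
loops in `Γ`, each of length at most `12 log b`. -/
theorem short_homologically_independent_simple_loops (G : MGraph) (b : ℕ) (hb : 3 ≤ b)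
    (hconn : G.Connected) (hbetti : G.bettiEq b) (hlen : G.totalLength = b) :
    ∃ c : Fin ((b + 1) / 2) → List (G.E × Bool),
      (∀ i, G.IsSimpleLoop (c i)) ∧
      (∀ i, G.walkLen (c i) ≤ 12 * Real.log b) ∧
      LinearIndependent ℝ (fun i => G.cycVec (c i)) := by
  have hb' : (3 : ℝ) ≤ b := by exact_mod_cast hb
  have hlog : 0 < Real.log b := Real.log_pos (by linarith)
  have hlen' : ∑ e ∈ (Finset.univ : Finset G.E), G.len e ≤ b := le_of_eq hlen
  have hbet : (Fintype.card G.E : ℝ) - Fintype.card G.V + 1 = b := by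
    have h := congrArg (Int.cast : ℤ → ℝ) (show _ = _ from hbetti)
    push_cast at h
    exact h
  have hk : (((b + 1) / 2 : ℕ) : ℝ) ≤ ((b : ℝ) + 1) / 2 := by
    have := Nat.cast_div_le (α := ℝ) (m := b + 1) (n := 2)
    push_cast at this
    exact this
  obtain ⟨c, h1, h2, -, h4⟩ := MGraph.loops_aux (G := G) (5 * Real.log b) (1 / 5) b
    (by linarith) (by norm_num)
    (by
      rw [show (1 / 5 : ℝ) * (5 * Real.log b) = Real.log b by ring, Real.exp_log (by linarith)]
      linarith) ((b + 1) / 2) Finset.univ hlen'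
    (by rw [Finset.card_univ]; linarith)
  exact ⟨c, h1, fun i => (h2 i).trans (by linarith), h4⟩
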